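/- Let q be an odd prime power, d ≥ 2, and E ⊆ 𝔽_q^d with |E| ≥ (4n/ln 2)·q^{(d+1)/2}. Then C_{2n} ≤ 2·|E|^{2n+1}/q^{2n}. -/

import Mathlib

/-- `C_n`: the number of unit-distance chains of length `n` in `E ⊆ 𝔽_q^d`, i.e. tuples
`(x^1, …, x^{n+1}) ∈ E^{n+1}` with `‖x^i − x^{i+1}‖ = 1` for `1 ≤ i ≤ n`,
where `‖x‖ = x_1^2 + ⋯ + x_d^2`. -/
def chainCount {F : Type} [Field F] [Fintype F] [DecidableEq F] {d : ℕ}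
    (E : Finset (Fin d → F)) (n : ℕ) : ℕ :=
  (Finset.univ.filter (fun x : Fin (n + 1) → (Fin d → F) =>
    (∀ i, x i ∈ E) ∧ ∀ i : Fin n, ∑ j, (x i.castSucc j - x i.succ j) ^ 2 = 1)).card


namespace KL
open Finset Polynomial

noncomputable def Hpoly {L : Type} [Field L] (p m : ℕ) (a : L) : L[X] :=
  ∑ i ∈ range (m+1), (X ^ (p^m + p^i) + C (a^(p^i)) * X ^ (p^m - p^i))

lemma Hpoly_monic {L : Type} [Field L] (p m : ℕ) (hp : 2 ≤ p) (a : L) :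
    (Hpoly p m a).Monic ∧ (Hpoly p m a).natDegree = 2 * p^m := by
  have hR : 0 < p^m := by positivity
  have key : Hpoly p m a = X^(2*p^m) + (C (a^(p^m)) * X ^ (p^m - p^m) +
      ∑ i ∈ range m, (X ^ (p^m + p^i) + C (a^(p^i)) * X ^ (p^m - p^i))) := by
    unfold Hpoly
    rw [Finset.sum_range_succ, two_mul]; ring
  have hdeg : (C (a^(p^m)) * X ^ (p^m - p^m) +
      ∑ i ∈ range m, (X ^ (p^m + p^i) + C (a^(p^i)) * X ^ (p^m - p^i))).degree <
      ((2*p^m : ℕ) : WithBot ℕ) := by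
    refine lt_of_le_of_lt (degree_add_le _ _) (max_lt ?_ ?_)
    · refine lt_of_le_of_lt (degree_C_mul_X_pow_le _ _) ?_
      norm_cast; omega
    · refine lt_of_le_of_lt (degree_sum_le _ _) ?_
      rw [Finset.sup_lt_iff (WithBot.bot_lt_coe _)]
      intro i hi
      have hi' : p^i < p^m := Nat.pow_lt_pow_right hp (Finset.mem_range.1 hi)
      refine lt_of_le_of_lt (degree_add_le _ _) (max_lt ?_ ?_)
      · rw [degree_X_pow]; norm_cast; omega
      · refine lt_of_le_of_lt (degree_C_mul_X_pow_le _ _) ?_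
        norm_cast; omega
  rw [key]
  refine ⟨monic_X_pow_add hdeg, ?_⟩
  rw [natDegree_add_eq_left_of_degree_lt, natDegree_X_pow]
  rwa [degree_X_pow]

lemma Hpoly_eval {L : Type} [Field L] (p m : ℕ) (hp : 2 ≤ p) (a x : L) (hx : x ≠ 0) :
    (Hpoly p m a).eval x = x^(p^m) * ∑ i ∈ range (m+1), (x^(p^i) + a^(p^i) * (x⁻¹)^(p^i)) := by
  unfold Hpoly
  rw [eval_finsetSum, Finset.mul_sum]
  refine Finset.sum_congr rfl fun i hi => ?_
  have hi' : p^i ≤ p^m := Nat.pow_le_pow_right (by omega) (by simpa [Nat.lt_succ_iff] using hi)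
  simp only [eval_add, eval_mul, eval_C, eval_pow, eval_X]
  rw [pow_sub₀ _ hx hi', pow_add, inv_pow]
  ring

lemma stepanov_core {L : Type} [Field L] [Fintype L] [DecidableEq L] (p m : ℕ) [Fact p.Prime]
    [CharP L p] (hcard : Fintype.card L = (p^(m+1))^2) (a c : L) :
    (univ.filter (fun x : L => x ≠ 0 ∧
      (∑ i ∈ range (m+1), (x^(p^i) + a^(p^i) * (x⁻¹)^(p^i)))^(p^(m+1)) =
        c - ∑ i ∈ range (m+1), (x^(p^i) + a^(p^i) * (x⁻¹)^(p^i)))).card ≤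
      p^m * p^(m+1) + 4 * p^(m+1) := by
  have hp : 2 ≤ p := (Fact.out : p.Prime).two_le
  obtain ⟨hHm, hHd⟩ := Hpoly_monic p m hp a
  have hHe := fun x hx => Hpoly_eval p m hp a x hx
  set H := Hpoly p m a
  set R := p^m with hR
  set P := p^(m+1) with hP
  have hPR : P = p * R := by rw [hP, hR, pow_succ]; ring
  have hR0 : 0 < R := by positivity
  have hP0 : 0 < P := by positivity
  have hHdeg : H.degree = ((2*R : ℕ) : WithBot ℕ) := by
    rw [degree_eq_natDegree hHm.ne_zero, hHd]
  set K : L[X] := C c * X^R - H with hK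
  have hKd : K.natDegree ≤ 2 * R := by
    refine (natDegree_sub_le _ _).trans (max_le ?_ hHd.le)
    exact (natDegree_C_mul_X_pow_le _ _).trans (by omega)
  let T := Fin (R+2) × Fin p × Fin R
  let psi : T → L[X] := fun t => X^(t.2.2.1 * P + t.1.1) * K^(t.2.1.1) * X^((p-1-t.2.1.1)*R)
  let phi : T → L[X] := fun t => X^(t.2.2.1 + t.1.1 * P) * H^(t.2.1.1) * X^((p-1-t.2.1.1)*R)
  set D := (R-1)*P + R + 2 + 2*(p-1)*R with hD
  have hpsid : ∀ t, (psi t).natDegree < D := by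
    rintro ⟨i, j, l⟩
    have h1 : (psi (i,j,l)).natDegree ≤ (l.1 * P + i.1) + j.1 * (2*R) + (p-1-j.1)*R := by
      refine natDegree_mul_le.trans (add_le_add (natDegree_mul_le.trans (add_le_add ?_ ?_)) ?_)
      · exact natDegree_X_pow_le _
      · exact natDegree_pow_le.trans (Nat.mul_le_mul_left _ hKd)
      · exact natDegree_X_pow_le _
    have hl : l.1 * P ≤ (R-1)*P := Nat.mul_le_mul_right _ (by omega)
    have hj : j.1 * (2*R) + (p-1-j.1)*R ≤ 2*(p-1)*R := by
      have := j.2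
      have h2 : j.1 * (2*R) + (p-1-j.1)*R = (2*j.1 + (p-1-j.1))*R := by ring
      rw [h2]
      exact Nat.mul_le_mul_right _ (by omega)
    have := i.2
    omega
  let Lm : (T → L) →ₗ[L] (Fin D → L) :=
    { toFun := fun b k => ∑ t, b t * (psi t).coeff k
      map_add' := by intro b b'; ext k; simp [add_mul, Finset.sum_add_distrib]
      map_smul' := by intro r b; ext k; simp [mul_assoc, Finset.mul_sum] }
  have hker : LinearMap.ker Lm ≠ ⊥ := by
    apply LinearMap.ker_ne_bot_of_finrank_lt
    simp only [Module.finrank_fintype_fun_eq_card, Fintype.card_fin, T, Fintype.card_prod]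
    have e1 : (R-1)*P + P = R * P := by
      obtain ⟨r, hr⟩ : ∃ r, R = r+1 := ⟨R-1, by omega⟩
      rw [hr]; simp; ring
    have e2 : 2*(p-1)*R + 2*R = 2*P := by
      obtain ⟨r, hr⟩ : ∃ r, p = r+1 := ⟨p-1, by omega⟩
      rw [hPR, hr]; simp; ring
    have e3 : (R+2)*(p*R) = R*P + 2*P := by rw [hPR]; ring
    have e4 : 2 * R ≤ P := by rw [hPR]; exact Nat.mul_le_mul_right _ hp
    rw [e3]; omega
  obtain ⟨b, hb, hb0⟩ := (Submodule.ne_bot_iff _).1 hker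
  have hPsi : ∑ t, C (b t) * psi t = 0 := by
    ext k
    rw [finsetSum_coeff]
    simp only [coeff_C_mul, coeff_zero]
    by_cases hk : k < D
    · exact congrFun (LinearMap.mem_ker.1 hb) ⟨k, hk⟩
    · refine Finset.sum_eq_zero fun t _ => ?_
      rw [coeff_eq_zero_of_natDegree_lt (lt_of_lt_of_le (hpsid t) (not_lt.1 hk)), mul_zero]
  set B : L[X] := ∑ t, C ((b t)^P) * phi t with hB
  have hphim : ∀ t, (phi t).Monic := fun t =>
    ((monic_X_pow _).mul (hHm.pow _)).mul (monic_X_pow _)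
  have hphid : ∀ t : T, (phi t).natDegree = t.2.2.1 + t.1.1*P + t.2.1.1 * (2*R) + (p-1-t.2.1.1)*R := by
    intro t
    simp only [phi]
    rw [Monic.natDegree_mul ((monic_X_pow _).mul (hHm.pow _)) (monic_X_pow _),
      Monic.natDegree_mul (monic_X_pow _) (hHm.pow _), hHm.natDegree_pow, hHd]
    simp
  have hphid' : ∀ t : T, (phi t).natDegree = (p-1)*R + (t.2.2.1 + R * (t.2.1.1 + p * t.1.1)) := by
    intro t
    rw [hphid]
    have h1 := t.2.1.2
    have h2 : (p-1)*R = t.2.1.1 * R + (p-1-t.2.1.1)*R := by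
      rw [← add_mul]; congr 1; omega
    rw [h2, hPR]; ring
  have hinj : ∀ t t' : T, (phi t).natDegree = (phi t').natDegree → t = t' := by
    rintro ⟨i, j, l⟩ ⟨i', j', l'⟩ h
    rw [hphid', hphid'] at h
    have h := Nat.add_left_cancel h
    simp only at h
    have hl : l.1 = l'.1 := by
      have := congrArg (· % R) h
      simpa [Nat.add_mul_mod_self_left, Nat.mod_eq_of_lt l.2, Nat.mod_eq_of_lt l'.2] using this
    rw [hl] at h
    have h := Nat.eq_of_mul_eq_mul_left hR0 (Nat.add_left_cancel h)
    have hj : j.1 = j'.1 := by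
      have := congrArg (· % p) h
      simpa [Nat.add_mul_mod_self_left, Nat.mod_eq_of_lt j.2, Nat.mod_eq_of_lt j'.2] using this
    rw [hj] at h
    have h := Nat.eq_of_mul_eq_mul_left (by omega) (Nat.add_left_cancel h)
    exact Prod.ext (Fin.ext h) (Prod.ext (Fin.ext hj) (Fin.ext hl))
  have hB0 : B ≠ 0 := by
    obtain ⟨t0, ht0⟩ := Function.ne_iff.1 hb0
    have hdeg := degree_sum_eq_of_disjoint (fun t => C ((b t)^P) * phi t) univ (by
      rintro t ⟨_, ht⟩ t' ⟨_, ht'⟩ hne heq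
      apply hne
      apply hinj
      have h1 : (b t)^P ≠ 0 := by
        intro h; apply ht; simp [h]
      have h2 : (b t')^P ≠ 0 := by
        intro h; apply ht'; simp [h]
      have := natDegree_eq_of_degree_eq heq
      simpa only [natDegree_C_mul h1, natDegree_C_mul h2] using this)
    intro h
    rw [← hB, h, degree_zero, eq_comm, Finset.sup_eq_bot_iff] at hdeg
    have := hdeg t0 (mem_univ _)
    rw [degree_eq_bot] at this
    have h1 : (b t0)^P ≠ 0 := pow_ne_zero _ ht0
    exact (mul_ne_zero (C_ne_zero.2 h1) (hphim t0).ne_zero) this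
  have hBd : B.natDegree ≤ R*P + 4*P := by
    refine natDegree_sum_le_of_forall_le _ _ fun t _ => ?_
    refine (natDegree_C_mul_le _ _).trans ?_
    rw [hphid']
    have h1 := t.1.2
    have h2 := t.2.1.2
    have h3 := t.2.2.2
    have h4 : R * (t.2.1.1 + p * t.1.1) ≤ P + (R+1)*P := by
      calc R * (t.2.1.1 + p * t.1.1) ≤ R * (p + p * (R+1)) := by gcongr <;> omega
        _ = _ := by rw [hPR]; ring
    have h5 : (p-1)*R ≤ P := by rw [hPR]; gcongr; omega
    have h6 : R ≤ P := by rw [hPR]; nlinarith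
    nlinarith
  have hBe : ∀ x : L, x ≠ 0 → (∑ i ∈ range (m+1), (x^(p^i) + a^(p^i) * (x⁻¹)^(p^i)))^P =
        c - ∑ i ∈ range (m+1), (x^(p^i) + a^(p^i) * (x⁻¹)^(p^i)) → B.eval x = 0 := by
    intro x hx hG
    set G := ∑ i ∈ range (m+1), (x^(p^i) + a^(p^i) * (x⁻¹)^(p^i)) with hGd
    have hHx : H.eval x = x^R * G := hHe x hx
    have hKx : K.eval x = x^R * (c - G) := by
      simp [hK, hHx]; ring
    have hfr : ∀ y : L, (y^P)^P = y := by
      intro y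
      rw [← pow_mul, ← sq, ← hcard, FiniteField.pow_card]
    have hx1 : x^(P*P) = x := by rw [pow_mul, hfr]
    have e1 : (B.eval x)^P * x^((p-1)*R) = x^((p-1)*R*P) * (∑ t, C (b t) * psi t).eval x := by
      rw [hB, eval_finsetSum, eval_finsetSum, hP, sum_pow_char_pow, Finset.sum_mul, Finset.mul_sum]
      rw [← hP]
      refine Finset.sum_congr rfl fun t _ => ?_
      simp only [phi, psi, eval_mul, eval_C, eval_pow, eval_X, hHx, hKx, mul_pow, hfr, ← hG]
      have h2 : (p-1)*R = R * t.2.1.1 + (p-1-t.2.1.1)*R := by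
        have := t.2.1.2
        rw [mul_comm R, ← add_mul]; congr 1; omega
      have h3 : (x^(t.2.2.1 + t.1.1*P))^P = x^(t.2.2.1*P) * x^t.1.1 := by
        rw [← pow_mul, add_mul, pow_add, mul_assoc, mul_comm t.1.1, pow_mul x (P*P), hx1]
      rw [h3, h2]
      simp only [pow_add, pow_mul, add_mul]
      ring
    rw [hPsi, eval_zero, mul_zero] at e1
    rcases mul_eq_zero.1 e1 with h | h
    · exact eq_zero_of_pow_eq_zero h
    · exact absurd h (pow_ne_zero _ hx)
  refine le_trans ?_ hBd
  refine le_trans (Finset.card_le_card (t := B.roots.toFinset) ?_)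
    ((Multiset.toFinset_card_le _).trans (card_roots' _))
  intro x hx
  simp only [mem_filter, mem_univ, true_and] at hx
  rw [Multiset.mem_toFinset, mem_roots hB0]
  exact hBe x hx.1 hx.2


noncomputable def psi (p : ℕ) [Fact p.Prime] (F : Type) [Field F] [Algebra (ZMod p) F] : AddChar F ℂ :=
  (ZMod.stdAddChar (N := p)).compAddMonoidHom (Algebra.trace (ZMod p) F).toAddMonoidHom

lemma psi_apply (p : ℕ) [Fact p.Prime] (F : Type) [Field F] [Algebra (ZMod p) F] (x : F) :
    psi p F x = ZMod.stdAddChar (N := p) (Algebra.trace (ZMod p) F x) := rfl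

noncomputable def Kl {F : Type} [Field F] [Fintype F] [DecidableEq F] (ψ : AddChar F ℂ) (a : F) : ℂ :=
  ∑ x ∈ univ.filter (fun x : F => x ≠ 0), ψ (x + a * x⁻¹)

lemma stepanov_count {L : Type} [Field L] [Fintype L] [DecidableEq L] (p m : ℕ) [Fact p.Prime]
    [Algebra (ZMod p) L] (hcard : Fintype.card L = (p^(m+1))^2) (a : L) (c : ZMod p) :
    ((univ.filter (fun x : L => x ≠ 0)).filter (fun x =>
      Algebra.trace (ZMod p) L (x + a * x⁻¹) = c)).card ≤
      p^m * p^(m+1) + 4 * p^(m+1) := by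
  have hch : CharP L p := charP_of_injective_algebraMap (algebraMap (ZMod p) L).injective p
  have hfr : Module.finrank (ZMod p) L = (m+1) + (m+1) := by
    have h := Module.card_eq_pow_finrank (K := ZMod p) (V := L)
    rw [hcard, ZMod.card, ← pow_mul] at h
    have := Nat.pow_right_injective (Fact.out : p.Prime).two_le h
    omega
  refine le_trans (Finset.card_le_card ?_) (stepanov_core p m hcard a (algebraMap (ZMod p) L c))
  intro x hx
  simp only [mem_filter, mem_univ, true_and] at hx ⊢
  refine ⟨hx.1, ?_⟩
  have h := FiniteField.algebraMap_trace_eq_sum_pow (ZMod p) L (x + a * x⁻¹)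
  rw [hx.2, hfr, Nat.card_zmod, Finset.sum_range_add] at h
  have e : ∀ i, (x + a * x⁻¹)^(p^i) = x^(p^i) + a^(p^i) * (x⁻¹)^(p^i) := by
    intro i; rw [add_pow_char_pow, mul_pow]
  have e2 : ∑ i ∈ range (m+1), (x + a * x⁻¹)^(p^(m+1+i)) =
      (∑ i ∈ range (m+1), (x^(p^i) + a^(p^i) * (x⁻¹)^(p^i)))^(p^(m+1)) := by
    rw [sum_pow_char_pow]
    refine Finset.sum_congr rfl fun i _ => ?_
    rw [← e, ← pow_mul, ← pow_add, add_comm i]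
  rw [e2] at h
  simp only [e] at h
  rw [h]; ring

lemma stepanov_bound {L : Type} [Field L] [Fintype L] [DecidableEq L] (p m : ℕ) [Fact p.Prime]
    [Algebra (ZMod p) L] (hcard : Fintype.card L = (p^(m+1))^2) (a : L) :
    ‖Kl (psi p L) a‖ ≤ 9 * p * (p:ℝ)^(m+1) := by
  have hp : 2 ≤ p := (Fact.out : p.Prime).two_le
  set S := univ.filter (fun x : L => x ≠ 0) with hS
  set f : L → ZMod p := fun x => Algebra.trace (ZMod p) L (x + a * x⁻¹) with hf
  set N : ZMod p → ℕ := fun c => (S.filter (fun x => f x = c)).card with hN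
  have hNle : ∀ c, N c ≤ p^m * p^(m+1) + 4 * p^(m+1) := fun c => stepanov_count p m hcard a c
  have hSc : S.card + 1 = (p^(m+1))^2 := by
    rw [hS, Finset.filter_ne', Finset.card_erase_of_mem (mem_univ _), Finset.card_univ, ← hcard]
    have := Fintype.card_pos (α := L)
    omega
  have hsum : ∑ c, N c = S.card := by
    rw [hN]
    exact (Finset.card_eq_sum_card_fiberwise (f := f) (t := univ) (fun _ _ => mem_univ _)).symm
  have hKl : Kl (psi p L) a = ∑ c, (N c : ℂ) * ZMod.stdAddChar (N := p) c := by
    unfold Kl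
    rw [← hS, ← Finset.sum_fiberwise_of_maps_to (g := f) (t := univ) (fun _ _ => mem_univ _)]
    refine Finset.sum_congr rfl fun c _ => ?_
    rw [Finset.sum_congr rfl (g := fun _ => ZMod.stdAddChar (N := p) c)]
    · rw [Finset.sum_const, nsmul_eq_mul]
    · intro x hx
      rw [psi_apply, ← (Finset.mem_filter.1 hx).2]
  have h0 : ∑ c : ZMod p, ZMod.stdAddChar (N := p) c = 0 := by
    apply AddChar.sum_eq_zero_of_ne_one
    have := ZMod.isPrimitive_stdAddChar p
    have h1 := this (one_ne_zero)
    rwa [AddChar.mulShift_one] at h1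
  have hKl2 : Kl (psi p L) a = ∑ c, ((N c : ℂ) - (p^m * p^(m+1) : ℕ)) * ZMod.stdAddChar (N := p) c := by
    simp only [sub_mul, Finset.sum_sub_distrib]
    rw [← Finset.mul_sum, h0, mul_zero, sub_zero, hKl]
  rw [hKl2]
  refine (norm_sum_le _ _).trans ?_
  have hterm : ∀ c, ‖((N c : ℂ) - (p^m * p^(m+1) : ℕ)) * ZMod.stdAddChar (N := p) c‖ ≤
      ((p:ℝ)^m * p^(m+1) + 4 * p^(m+1) - N c) + 4 * p^(m+1) := by
    intro c
    rw [norm_mul, AddChar.norm_apply, mul_one]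
    have e : ((N c : ℂ) - (p^m * p^(m+1) : ℕ)) = (((N c : ℝ) - ((p^m * p^(m+1) : ℕ) : ℝ) : ℝ) : ℂ) := by
      push_cast; ring
    rw [e, Complex.norm_real, Real.norm_eq_abs]
    have h1 : (N c : ℝ) ≤ (p:ℝ)^m * p^(m+1) + 4 * p^(m+1) := by exact_mod_cast hNle c
    have h2 : (0:ℝ) ≤ (p:ℝ)^(m+1) := by positivity
    push_cast
    rw [abs_le]; constructor <;> linarith
  refine (Finset.sum_le_sum fun c _ => hterm c).trans ?_
  rw [Finset.sum_add_distrib, Finset.sum_sub_distrib]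
  simp only [Finset.sum_const, Finset.card_univ, ZMod.card, nsmul_eq_mul]
  have h3 : ∑ c, (N c : ℝ) + 1 = ((p:ℝ)^(m+1))^2 := by
    rw [← Nat.cast_sum, hsum]; exact_mod_cast hSc
  have h4 : (p:ℝ) * ((p:ℝ)^m * p^(m+1)) = ((p:ℝ)^(m+1))^2 := by ring
  have h5 : (1:ℝ) ≤ p * (p:ℝ)^(m+1) := by
    have : (1:ℝ) ≤ p := by exact_mod_cast (by omega : 1 ≤ p)
    have h6 : (1:ℝ) ≤ (p:ℝ)^(m+1) := one_le_pow₀ this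
    nlinarith
  nlinarith

lemma sum_comp_sq {F : Type} [Field F] [Fintype F] [DecidableEq F] (hF : ringChar F ≠ 2) (φ : F → ℂ) :
    ∑ v, φ (v^2) = ∑ w, (1 + (quadraticChar F w : ℂ)) * φ w := by
  rw [← Finset.sum_fiberwise_of_maps_to (g := fun v : F => v^2) (t := univ) (fun _ _ => mem_univ _)]
  refine Finset.sum_congr rfl fun w _ => ?_
  rw [Finset.sum_congr rfl (g := fun _ => φ w)]
  · rw [Finset.sum_const, nsmul_eq_mul]
    congr 1
    have h := quadraticChar_card_sqrts hF w
    have h2 : (univ.filter (fun v : F => v^2 = w)) = {x : F | x ^ 2 = w}.toFinset := by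
      ext; simp
    rw [h2]
    have h3 := congrArg (Int.cast : ℤ → ℂ) h
    push_cast at h3
    rw [add_comm, ← h3]
  · intro x hx
    rw [(Finset.mem_filter.1 hx).2]

lemma sum_twist {F : Type} [Field F] [Fintype F] [DecidableEq F] (hF : ringChar F ≠ 2) (δ : F)
    (hδ : ¬ IsSquare δ) (φ : F → ℂ) :
    ∑ v, φ (v^2) + ∑ v, φ (δ * v^2) = 2 * ∑ w, φ w := by
  have hδ0 : δ ≠ 0 := by rintro rfl; exact hδ (IsSquare.zero)
  have hη : quadraticChar F δ = -1 := quadraticChar_neg_one_iff_not_isSquare.2 hδ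
  rw [sum_comp_sq hF φ, sum_comp_sq hF (fun w => φ (δ * w))]
  have h : ∑ w, (1 - (quadraticChar F w : ℂ)) * φ w =
      ∑ w, (1 + (quadraticChar F w : ℂ)) * φ (δ * w) := by
    refine (Fintype.sum_bijective (fun w => δ * w) (mulLeft_bijective₀ δ hδ0) _ _ fun w => ?_).symm
    rw [map_mul, hη]; push_cast; ring
  rw [← h, ← Finset.sum_add_distrib, Finset.mul_sum]
  refine Finset.sum_congr rfl fun w _ => ?_
  ring

noncomputable def SS {F : Type} [Field F] [Fintype F] [DecidableEq F] (ψ : AddChar F ℂ) (a δ : F) : ℂ :=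
  ∑ u : F, ∑ v : F, if u^2 - δ * v^2 = 0 then 0 else ψ (2*u*(1 + a * (u^2 - δ * v^2)⁻¹))

lemma sum_mul_eq {F : Type} [Field F] [Fintype F] [DecidableEq F] {ψ : AddChar F ℂ} (hψ : ψ ≠ 1)
    (b : F) : ∑ x, ψ (x * b) = if b = 0 then (Fintype.card F : ℂ) else 0 := by
  rw [AddChar.sum_mulShift b (AddChar.IsPrimitive.of_ne_one hψ)]
  push_cast
  rfl

lemma two_ne {F : Type} [Field F] (hF : ringChar F ≠ 2) : (2:F) ≠ 0 := Ring.two_ne_zero hF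

lemma SS_add {F : Type} [Field F] [Fintype F] [DecidableEq F] (hF : ringChar F ≠ 2) {ψ : AddChar F ℂ}
    (hψ : ψ ≠ 1) (a δ : F) (ha : a ≠ 0) (hδ : ¬ IsSquare δ) :
    SS ψ a 1 + SS ψ a δ = 2 * Fintype.card F := by
  unfold SS
  rw [← Finset.sum_add_distrib]
  have h1 : ∀ u : F, (∑ v : F, if u^2 - 1 * v^2 = 0 then 0 else ψ (2*u*(1 + a * (u^2 - 1 * v^2)⁻¹))) +
      (∑ v : F, if u^2 - δ * v^2 = 0 then 0 else ψ (2*u*(1 + a * (u^2 - δ * v^2)⁻¹))) =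
      2 * ∑ n : F, if n = 0 then 0 else ψ (2*u*(1 + a * n⁻¹)) := by
    intro u
    have := sum_twist hF δ hδ (fun w => if u^2 - w = 0 then 0 else ψ (2*u*(1 + a * (u^2 - w)⁻¹)))
    simp only [one_mul]
    rw [this]
    congr 1
    exact Fintype.sum_bijective (fun w => u^2 - w) (Equiv.subLeft (u^2)).bijective _ _ fun w => rfl
  rw [Finset.sum_congr rfl fun u _ => h1 u, ← Finset.mul_sum, Finset.sum_comm]
  congr 1
  have h2 : ∀ n : F, (∑ u : F, if n = 0 then 0 else ψ (2*u*(1 + a * n⁻¹))) =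
      if n = -a then (Fintype.card F : ℂ) else 0 := by
    intro n
    by_cases hn : n = 0
    · subst hn; simp [ha]
    · simp only [hn, if_false]
      have e : ∀ u, 2*u*(1 + a * n⁻¹) = u * (2 * (1 + a * n⁻¹)) := fun u => by ring
      simp only [e, sum_mul_eq hψ]
      congr 1
      rw [mul_eq_zero, or_iff_right (two_ne hF), eq_iff_iff]
      constructor
      · intro h
        have : n * (1 + a * n⁻¹) = 0 := by rw [h, mul_zero]
        rw [mul_add, mul_one, mul_left_comm, mul_inv_cancel₀ hn, mul_one] at this
        exact eq_neg_of_add_eq_zero_left this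
      · rintro rfl
        field_simp; ring
  rw [Finset.sum_congr rfl fun n _ => h2 n]
  simp

lemma Kl_sq {F : Type} [Field F] [Fintype F] [DecidableEq F] (hF : ringChar F ≠ 2) (ψ : AddChar F ℂ)
    (a : F) : Kl ψ a ^ 2 = SS ψ a 1 := by
  unfold Kl SS
  rw [sq, Finset.sum_mul_sum, ← Finset.sum_product', ← Finset.sum_product', ← Finset.filter_product,
    Finset.univ_product_univ, Finset.sum_filter]
  symm
  have h2 := two_ne hF
  refine Fintype.sum_bijective (fun z : F × F => (z.1 + z.2, z.1 - z.2)) ?_ _ _ ?_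
  · rw [Fintype.bijective_iff_injective_and_card]
    refine ⟨?_, rfl⟩
    rintro ⟨u, v⟩ ⟨u', v'⟩ h
    simp only [Prod.mk.injEq] at h ⊢
    constructor
    · apply mul_left_cancel₀ h2; linear_combination h.1 + h.2
    · apply mul_left_cancel₀ h2; linear_combination h.1 - h.2
  · rintro ⟨u, v⟩
    have e : u^2 - 1 * v^2 = (u+v)*(u-v) := by ring
    simp only [e, mul_eq_zero]
    by_cases h : u + v = 0 ∨ u - v = 0
    · rw [if_pos h, if_neg (by tauto)]
    · rw [if_neg h, if_pos (by tauto), ← AddChar.map_add_eq_mul]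
      push Not at h
      congr 1
      have h3 := h.1
      have h4 := h.2
      field_simp
      ring

lemma trace_quad {F : Type} [Field F] (δ : F) (z : QuadraticAlgebra F δ 0) :
    Algebra.trace F (QuadraticAlgebra F δ 0) z = 2 * z.re := by
  rw [Algebra.trace_eq_matrix_trace (QuadraticAlgebra.basis δ 0), Matrix.trace_fin_two]
  simp only [Algebra.leftMulMatrix_eq_repr_mul, QuadraticAlgebra.basis_repr_apply]
  have h0 : (QuadraticAlgebra.basis δ 0 : Module.Basis (Fin 2) F (QuadraticAlgebra F δ 0)) 0 = ⟨1, 0⟩ := by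
    apply (QuadraticAlgebra.basis δ 0).repr.injective
    rw [Module.Basis.repr_self]
    ext i; fin_cases i <;> simp [QuadraticAlgebra.basis_repr_apply]
  have h1 : (QuadraticAlgebra.basis δ 0 : Module.Basis (Fin 2) F (QuadraticAlgebra F δ 0)) 1 = ⟨0, 1⟩ := by
    apply (QuadraticAlgebra.basis δ 0).repr.injective
    rw [Module.Basis.repr_self]
    ext i; fin_cases i <;> simp [QuadraticAlgebra.basis_repr_apply]
  rw [h0, h1]
  simp
  ring

lemma psi_ne_one (p : ℕ) [Fact p.Prime] (F : Type) [Field F] [Fintype F] [Algebra (ZMod p) F] :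
    psi p F ≠ 1 := by
  rw [AddChar.ne_one_iff]
  obtain ⟨x, hx⟩ := Algebra.trace_surjective (ZMod p) F 1
  refine ⟨x, ?_⟩
  rw [psi_apply, hx]
  have := ZMod.isPrimitive_stdAddChar p
  have h1 := this (one_ne_zero)
  rw [AddChar.mulShift_one] at h1
  exact (AddChar.zmod_char_ne_one_iff p _).1 h1

lemma quad_step (p : ℕ) [Fact p.Prime] (hp2 : p ≠ 2) (F : Type) [Field F] [Fintype F] [DecidableEq F]
    [Algebra (ZMod p) F] (a : F) (ha : a ≠ 0) :
    ∃ (L : Type) (_ : Field L) (_ : Fintype L) (_ : DecidableEq L) (_ : Algebra (ZMod p) L) (a' : L),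
      a' ≠ 0 ∧ Fintype.card L = Fintype.card F ^ 2 ∧
      Kl (psi p L) a' = 2 * Fintype.card F - Kl (psi p F) a ^ 2 := by
  have hch : CharP F p := charP_of_injective_algebraMap (algebraMap (ZMod p) F).injective p
  have hF : ringChar F ≠ 2 := by rw [ringChar.eq F p]; exact hp2
  obtain ⟨δ, hδ⟩ := FiniteField.exists_nonsquare hF
  have hfact : Fact (∀ r : F, r ^ 2 ≠ δ + 0 * r) := ⟨fun r h => hδ ⟨r, by rw [← sq, h]; ring⟩⟩
  let e : QuadraticAlgebra F δ 0 ≃ F × F :=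
    { toFun := fun z => (z.re, z.im)
      invFun := fun z => ⟨z.1, z.2⟩
      left_inv := fun _ => rfl
      right_inv := fun _ => rfl }
  let ft : Fintype (QuadraticAlgebra F δ 0) := Fintype.ofEquiv _ e.symm
  let de : DecidableEq (QuadraticAlgebra F δ 0) := Classical.decEq _
  refine ⟨QuadraticAlgebra F δ 0, inferInstance, ft, de, inferInstance, algebraMap F _ a, ?_, ?_, ?_⟩
  · rwa [Ne, FaithfulSMul.algebraMap_eq_zero_iff]
  · rw [Fintype.card_congr e, Fintype.card_prod, sq]
  · rw [eq_sub_iff_add_eq, Kl_sq hF, ← SS_add hF (psi_ne_one p F) a δ ha hδ, add_comm]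
    congr 1
    unfold Kl SS
    rw [← Finset.sum_product', Finset.univ_product_univ, Finset.sum_filter]
    refine Fintype.sum_bijective e e.bijective _ _ ?_
    intro z
    have hn : z.norm = z.re^2 - δ * z.im^2 := by rw [QuadraticAlgebra.norm_def]; ring
    have hz : (z.re^2 - δ * z.im^2 = 0) ↔ z = 0 := by
      rw [← hn, QuadraticAlgebra.norm_eq_zero_iff_eq_zero]
    simp only [e, Equiv.coe_fn_mk, hz]
    by_cases h : z = 0
    · simp [h]
    · rw [if_neg h, if_pos h, psi_apply, psi_apply]
      rw [← Algebra.trace_trace (R := ZMod p) (S := F), trace_quad]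
      congr 2
      have hi : (z⁻¹).re = (z.re^2 - δ * z.im^2)⁻¹ * z.re := by
        rw [← hn, QuadraticAlgebra.inv_def]; simp
      rw [QuadraticAlgebra.re_add, QuadraticAlgebra.re_mul, hi]
      simp
      ring

lemma weil_kloosterman (p : ℕ) [Fact p.Prime] (hp2 : p ≠ 2) (F : Type) [Field F] [Fintype F]
    [DecidableEq F] [Algebra (ZMod p) F] (a : F) (ha : a ≠ 0) :
    ‖Kl (psi p F) a‖ ≤ 2 * √(Fintype.card F) := by
  by_contra! hcon
  have hs0 : 0 < √(Fintype.card F : ℝ) := Real.sqrt_pos.2 (by exact_mod_cast Fintype.card_pos)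
  obtain ⟨ε, hε, hε2⟩ : ∃ ε : ℝ, 0 < ε ∧ (2 + ε) * √(Fintype.card F) ≤ ‖Kl (psi p F) a‖ := by
    refine ⟨‖Kl (psi p F) a‖ / √(Fintype.card F) - 2, ?_, ?_⟩
    · rw [sub_pos, lt_div_iff₀ hs0]; exact hcon
    · rw [add_sub_cancel, div_mul_cancel₀ _ hs0.ne']
  have tower : ∀ j : ℕ, ∃ (L : Type) (_ : Field L) (_ : Fintype L) (_ : DecidableEq L)
      (_ : Algebra (ZMod p) L) (a' : L), a' ≠ 0 ∧ (1 ≤ j → ∃ m, Fintype.card L = (p^(m+1))^2) ∧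
      (2 + 4^j * ε) * √(Fintype.card L) ≤ ‖Kl (psi p L) a'‖ := by
    intro j
    induction j with
    | zero => exact ⟨F, inferInstance, inferInstance, inferInstance, inferInstance, a, ha, by simp, by simpa using hε2⟩
    | succ j ih =>
      obtain ⟨L, i1, i2, i3, i4, b, hb, -, hL⟩ := ih
      obtain ⟨M, j1, j2, j3, j4, c, hc, hM, hK⟩ := quad_step p hp2 L b hb
      refine ⟨M, j1, j2, j3, j4, c, hc, fun _ => ?_, ?_⟩
      · have h := Module.card_eq_pow_finrank (K := ZMod p) (V := L)
        rw [ZMod.card] at h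
        have h1 : 0 < Module.finrank (ZMod p) L := Module.finrank_pos
        obtain ⟨m, hm⟩ : ∃ m, Module.finrank (ZMod p) L = m + 1 := ⟨_, (Nat.succ_pred_eq_of_pos h1).symm⟩
        exact ⟨m, by rw [hM, h, hm]⟩
      · rw [hK, hM]
        push_cast
        rw [Real.sqrt_sq (by positivity)]
        have hq : √(Fintype.card L : ℝ)^2 = Fintype.card L := Real.sq_sqrt (by positivity)
        have h1 : ‖Kl (psi p L) b ^ 2‖ - ‖(2 * (Fintype.card L) : ℂ)‖ ≤
            ‖2 * (Fintype.card L : ℂ) - Kl (psi p L) b ^ 2‖ := by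
          rw [norm_sub_rev]; exact norm_sub_norm_le _ _
        have h2 : ‖(2 * (Fintype.card L) : ℂ)‖ = 2 * Fintype.card L := by
          rw [norm_mul]; simp
        rw [h2, norm_pow] at h1
        have h4 : (0:ℝ) < 4^j * ε := by positivity
        have h3 : ((2 + 4^j * ε) * √(Fintype.card L : ℝ))^2 ≤ ‖Kl (psi p L) b‖^2 := by
          apply pow_le_pow_left₀ (by positivity) hL
        rw [mul_pow, hq] at h3
        have h5 : (0:ℝ) ≤ Fintype.card L := by positivity
        refine le_trans ?_ h1
        rw [pow_succ]
        nlinarith [mul_nonneg (sq_nonneg (4^j * ε)) h5]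
  obtain ⟨j, hj⟩ := pow_unbounded_of_one_lt (9 * p / ε) (by norm_num : (1:ℝ) < 4)
  obtain ⟨L, i1, i2, i3, i4, b, hb, hm, hL⟩ := tower (j+1)
  obtain ⟨m, hm⟩ := hm (by omega)
  have h1 := stepanov_bound p m hm b
  rw [hm] at hL
  push_cast at hL
  rw [Real.sqrt_sq (by positivity)] at hL
  have h2 := hL.trans h1
  have hp0 : (0:ℝ) < p := by exact_mod_cast (Fact.out : p.Prime).pos
  have h3 := le_of_mul_le_mul_right h2 (by positivity)
  rw [div_lt_iff₀ hε] at hj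
  have h4 : (0:ℝ) < 4^j * ε := by positivity
  rw [pow_succ] at h3
  nlinarith

noncomputable def qc {F : Type} [Field F] [Fintype F] [DecidableEq F] (x : F) : ℂ := (quadraticChar F x : ℂ)

lemma qc_mul {F : Type} [Field F] [Fintype F] [DecidableEq F] (x y : F) : qc (x*y) = qc x * qc y := by
  unfold qc
  rw [map_mul, Int.cast_mul]

lemma qc_sq {F : Type} [Field F] [Fintype F] [DecidableEq F] {x : F} (hx : x ≠ 0) : qc x ^ 2 = 1 := by
  have := quadraticChar_sq_one hx
  unfold qc
  exact_mod_cast this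

lemma qc_norm {F : Type} [Field F] [Fintype F] [DecidableEq F] {x : F} (hx : x ≠ 0) : ‖qc x‖ = 1 := by
  have h := congrArg norm (qc_sq hx)
  rw [norm_pow, norm_one] at h
  exact (pow_eq_one_iff_of_nonneg (norm_nonneg _) two_ne_zero).1 h

lemma qc_inv {F : Type} [Field F] [Fintype F] [DecidableEq F] {x : F} (hx : x ≠ 0) : qc x⁻¹ = qc x := by
  have h1 : qc x⁻¹ * qc x = 1 := by
    rw [← qc_mul, inv_mul_cancel₀ hx]; simp [qc]
  have h2 := qc_sq hx
  have h3 : qc x ≠ 0 := by intro h; rw [h] at h2; norm_num at h2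
  apply mul_right_cancel₀ h3
  rw [h1, ← sq, h2]

noncomputable def gs {F : Type} [Field F] [Fintype F] [DecidableEq F] (ψ : AddChar F ℂ) : ℂ :=
  ∑ x, qc x * ψ x

lemma gs_norm {F : Type} [Field F] [Fintype F] [DecidableEq F] (hF : ringChar F ≠ 2) {ψ : AddChar F ℂ}
    (hψ : ψ ≠ 1) : ‖gs ψ‖ = √(Fintype.card F) := by
  have hinj : Function.Injective (Int.castRingHom ℂ) := (Int.castRingHom ℂ).injective_int
  have h := gaussSum_sq (χ := (quadraticChar F).ringHomComp (Int.castRingHom ℂ)) (ψ := ψ)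
    ((MulChar.ringHomComp_ne_one_iff hinj).2 (quadraticChar_ne_one hF))
    ((quadraticChar_isQuadratic F).comp _) (AddChar.IsPrimitive.of_ne_one hψ)
  have h2 : gaussSum ((quadraticChar F).ringHomComp (Int.castRingHom ℂ)) ψ = gs ψ := by
    unfold gaussSum gs qc; rfl
  have h3 : ((quadraticChar F).ringHomComp (Int.castRingHom ℂ)) (-1) = qc (-1 : F) := rfl
  rw [h2, h3] at h
  have h4 := congrArg norm h
  rw [norm_pow, norm_mul, qc_norm (by simp), one_mul, Complex.norm_natCast] at h4
  rw [← h4, Real.sqrt_sq (norm_nonneg _)]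

lemma gauss_scaled {F : Type} [Field F] [Fintype F] [DecidableEq F] (hF : ringChar F ≠ 2) {ψ : AddChar F ℂ}
    (hψ : ψ ≠ 1) (b : F) (hb : b ≠ 0) : ∑ x, ψ (b * x^2) = qc b * gs ψ := by
  rw [sum_comp_sq hF (fun w => ψ (b * w))]
  simp only [add_mul, one_mul, Finset.sum_add_distrib]
  have h1 : ∑ x, ψ (b * x) = 0 := by
    simp only [mul_comm b]
    rw [sum_mul_eq hψ, if_neg hb]
  rw [h1, zero_add, gs, Finset.mul_sum]
  refine Fintype.sum_bijective (fun w => b * w) (mulLeft_bijective₀ b hb) _ _ fun w => ?_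
  rw [qc_mul, ← mul_assoc, ← mul_assoc, ← sq, qc_sq hb, one_mul]
  rfl

lemma complete_sq {F : Type} [Field F] [Fintype F] [DecidableEq F] (hF : ringChar F ≠ 2) {ψ : AddChar F ℂ}
    (hψ : ψ ≠ 1) (s z : F) (hs : s ≠ 0) :
    ∑ m, ψ (-(4*s)⁻¹ * m^2 + m * z) = qc (-s) * gs ψ * ψ (s * z^2) := by
  have h2 := two_ne hF
  have h4 : (4:F) ≠ 0 := by
    have : (4:F) = 2*2 := by norm_num
    rw [this]; exact mul_ne_zero h2 h2
  have e : qc (-s) = qc (-(4*s)⁻¹) := by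
    have : -(4*s)⁻¹ = (-s)⁻¹ * (2⁻¹ * 2⁻¹) := by
      field_simp; norm_num
    rw [this, qc_mul, qc_mul, ← sq, qc_sq (inv_ne_zero h2), mul_one, qc_inv (neg_ne_zero.2 hs)]
  rw [e, ← gauss_scaled hF hψ _ (neg_ne_zero.2 (inv_ne_zero (mul_ne_zero h4 hs))), Finset.sum_mul]
  refine Fintype.sum_bijective (fun m => m - 2*s*z) (Equiv.subRight (2*s*z)).bijective _ _ fun m => ?_
  rw [← AddChar.map_add_eq_mul]
  congr 1
  field_simp
  ring

lemma sum_ne_zero_mul {F : Type} [Field F] [Fintype F] [DecidableEq F] {ψ : AddChar F ℂ}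
    (hψ : ψ ≠ 1) (c : F) :
    ∑ x ∈ univ.filter (fun x : F => x ≠ 0), ψ (c * x⁻¹) =
      (if c = 0 then (Fintype.card F : ℂ) else 0) - 1 := by
  have h1 : ∑ x ∈ univ.filter (fun x : F => x ≠ 0), ψ (c * x⁻¹) =
      ∑ x ∈ univ.filter (fun x : F => x ≠ 0), ψ (x * c) := by
    refine Finset.sum_bij' (fun x _ => x⁻¹) (fun x _ => x⁻¹) ?_ ?_ ?_ ?_ ?_ <;> simp [mul_comm]
  rw [h1, ← sum_mul_eq hψ c, Finset.filter_ne', eq_sub_iff_add_eq]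
  have := Finset.sum_erase_add univ (fun x => ψ (x * c)) (mem_univ (0:F))
  simpa using this

noncomputable def KD {F : Type} [Field F] [Fintype F] [DecidableEq F] (ψ : AddChar F ℂ) (d : ℕ) (b : F) : ℂ :=
  ∑ s ∈ univ.filter (fun x : F => x ≠ 0), qc (-s) ^ d * ψ (s + b * s⁻¹)

lemma salie {F : Type} [Field F] [Fintype F] [DecidableEq F] (hF : ringChar F ≠ 2) {ψ : AddChar F ℂ}
    (hψ : ψ ≠ 1) (b : F) :
    ‖∑ s ∈ univ.filter (fun x : F => x ≠ 0), qc (-s) * ψ (s + b * s⁻¹)‖ ≤ 2 * √(Fintype.card F) := by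
  set T := ∑ s ∈ univ.filter (fun x : F => x ≠ 0), qc (-s) * ψ (s + b * s⁻¹) with hT
  have h2 := two_ne hF
  have h4 : (4:F) ≠ 0 := by
    have : (4:F) = 2*2 := by norm_num
    rw [this]; exact mul_ne_zero h2 h2
  have h1 : gs ψ * T = Fintype.card F * ∑ y ∈ univ.filter (fun y : F => y^2 = 4*b), ψ y := by
    calc gs ψ * T = ∑ s ∈ univ.filter (fun x : F => x ≠ 0), ∑ y, ψ y * ψ ((b - y^2/4) * s⁻¹) := by
          rw [hT, Finset.mul_sum]
          refine Finset.sum_congr rfl fun s hs => ?_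
          have hs : s ≠ 0 := by simpa using hs
          have h := complete_sq hF hψ s 1 hs
          simp only [one_pow, mul_one] at h
          rw [AddChar.map_add_eq_mul]
          have : gs ψ * (qc (-s) * (ψ s * ψ (b * s⁻¹))) = (qc (-s) * gs ψ * ψ s) * ψ (b * s⁻¹) := by ring
          rw [this, ← h, Finset.sum_mul]
          refine Finset.sum_congr rfl fun y _ => ?_
          rw [← AddChar.map_add_eq_mul, ← AddChar.map_add_eq_mul]
          congr 1
          field_simp
          ring
      _ = ∑ y, ψ y * ((if b - y^2/4 = 0 then (Fintype.card F : ℂ) else 0) - 1) := by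
          rw [Finset.sum_comm]
          refine Finset.sum_congr rfl fun y _ => ?_
          rw [← Finset.mul_sum, sum_ne_zero_mul hψ]
      _ = _ := by
          simp only [mul_sub, mul_one, Finset.sum_sub_distrib]
          rw [AddChar.sum_eq_zero_of_ne_one hψ, sub_zero, Finset.mul_sum, Finset.sum_filter]
          refine Finset.sum_congr rfl fun y _ => ?_
          have : b - y^2/4 = 0 ↔ y^2 = 4*b := by
            rw [sub_eq_zero, eq_div_iff h4]
            constructor <;> intro h <;> linear_combination -h
          simp only [this]
          split_ifs <;> ring
  have h3 := congrArg norm h1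
  rw [norm_mul, norm_mul, gs_norm hF hψ, Complex.norm_natCast] at h3
  have h5 : ‖∑ y ∈ univ.filter (fun y : F => y^2 = 4*b), ψ y‖ ≤ 2 := by
    refine (norm_sum_le _ _).trans ?_
    simp only [AddChar.norm_apply, Finset.sum_const, nsmul_eq_mul, mul_one]
    have h := quadraticChar_card_sqrts hF (4*b)
    have h6 : (univ.filter (fun v : F => v^2 = 4*b)) = {x : F | x ^ 2 = 4*b}.toFinset := by
      ext; simp
    rw [h6]
    have h7 : quadraticChar F (4*b) ≤ 1 := by
      by_cases h0 : 4 * b = 0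
      · simp [h0]
      · rcases quadraticChar_dichotomy h0 with h | h <;> rw [h] <;> norm_num
    have h8 : (({x : F | x ^ 2 = 4*b}.toFinset.card : ℕ) : ℤ) ≤ 2 := by rw [h]; linarith
    exact_mod_cast h8
  have hs0 : 0 < √(Fintype.card F : ℝ) := Real.sqrt_pos.2 (by exact_mod_cast Fintype.card_pos)
  have hq : √(Fintype.card F : ℝ) * √(Fintype.card F : ℝ) = Fintype.card F := Real.mul_self_sqrt (by positivity)
  apply le_of_mul_le_mul_left _ hs0
  rw [h3]
  calc (Fintype.card F : ℝ) * _ ≤ Fintype.card F * 2 := by gcongr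
    _ = _ := by linear_combination (-2) * hq

lemma KD_bound (p : ℕ) [Fact p.Prime] (hp2 : p ≠ 2) (F : Type) [Field F] [Fintype F]
    [DecidableEq F] [Algebra (ZMod p) F] (d : ℕ) (b : F) :
    ‖KD (psi p F) d b‖ ≤ 2 * √(Fintype.card F) := by
  have hch : CharP F p := charP_of_injective_algebraMap (algebraMap (ZMod p) F).injective p
  have hF : ringChar F ≠ 2 := by rw [ringChar.eq F p]; exact hp2
  unfold KD
  rcases Nat.even_or_odd' d with ⟨k, rfl | rfl⟩
  · have h : ∑ s ∈ univ.filter (fun x : F => x ≠ 0), qc (-s) ^ (2*k) * psi p F (s + b * s⁻¹) =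
        Kl (psi p F) b := by
      refine Finset.sum_congr rfl fun s hs => ?_
      have hs : s ≠ 0 := by simpa using hs
      rw [pow_mul, qc_sq (neg_ne_zero.2 hs), one_pow, one_mul]
    rw [h]
    by_cases hb : b = 0
    · have h2 : Kl (psi p F) b = -1 := by
        have := sum_ne_zero_mul (psi_ne_one p F) 1
        rw [if_neg one_ne_zero, zero_sub] at this
        rw [← this, hb]
        unfold Kl
        refine Finset.sum_bij' (fun x _ => x⁻¹) (fun x _ => x⁻¹) ?_ ?_ ?_ ?_ ?_ <;> simp
      rw [h2, norm_neg, norm_one]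
      have : 1 ≤ √(Fintype.card F : ℝ) := Real.one_le_sqrt.2 (by exact_mod_cast Fintype.card_pos)
      linarith
    · exact weil_kloosterman p hp2 F b hb
  · have h : ∑ s ∈ univ.filter (fun x : F => x ≠ 0), qc (-s) ^ (2*k+1) * psi p F (s + b * s⁻¹) =
        ∑ s ∈ univ.filter (fun x : F => x ≠ 0), qc (-s) * psi p F (s + b * s⁻¹) := by
      refine Finset.sum_congr rfl fun s hs => ?_
      have hs : s ≠ 0 := by simpa using hs
      rw [pow_succ, pow_mul, qc_sq (neg_ne_zero.2 hs), one_pow, one_mul]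
    rw [h]
    exact salie hF (psi_ne_one p F) b

def nrm {F : Type} [Field F] {d : ℕ} (x : Fin d → F) : F := ∑ j, x j ^ 2

def dot {F : Type} [Field F] {d : ℕ} (x y : Fin d → F) : F := ∑ j, x j * y j

lemma psi_sum {F : Type} [Field F] {ι : Type} (ψ : AddChar F ℂ) (s : Finset ι) (f : ι → F) :
    ψ (∑ i ∈ s, f i) = ∏ i ∈ s, ψ (f i) := by
  classical
  induction s using Finset.induction_on with
  | empty => simp
  | insert a s ha ih => rw [Finset.sum_insert ha, Finset.prod_insert ha, AddChar.map_add_eq_mul, ih]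

lemma sum_prod_char {F : Type} [Field F] [Fintype F] [DecidableEq F] {d : ℕ} (ψ : AddChar F ℂ)
    (h : Fin d → F → F) :
    ∑ m : Fin d → F, ψ (∑ j, h j (m j)) = ∏ j, ∑ t, ψ (h j t) := by
  rw [Finset.prod_univ_sum, Fintype.piFinset_univ]
  refine Finset.sum_congr rfl fun m _ => ?_
  exact psi_sum ψ _ _

lemma sum_dot {F : Type} [Field F] [Fintype F] [DecidableEq F] {d : ℕ} {ψ : AddChar F ℂ} (hψ : ψ ≠ 1)
    (z : Fin d → F) :
    ∑ m : Fin d → F, ψ (dot m z) = if z = 0 then (Fintype.card F : ℂ)^d else 0 := by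
  unfold dot
  rw [sum_prod_char ψ (fun j t => t * z j)]
  simp only [sum_mul_eq hψ]
  split_ifs with hz
  · simp [hz]
  · obtain ⟨j, hj⟩ := Function.ne_iff.1 hz
    exact Finset.prod_eq_zero (mem_univ j) (if_neg hj)

lemma char_nrm {F : Type} [Field F] [Fintype F] [DecidableEq F] (hF : ringChar F ≠ 2) {d : ℕ}
    {ψ : AddChar F ℂ} (hψ : ψ ≠ 1) (s : F) (hs : s ≠ 0) (z : Fin d → F) :
    ∑ m : Fin d → F, ψ (-(4*s)⁻¹ * nrm m + dot m z) = (qc (-s) * gs ψ)^d * ψ (s * nrm z) := by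
  have e : ∀ m : Fin d → F, -(4*s)⁻¹ * nrm m + dot m z = ∑ j, (-(4*s)⁻¹ * (m j)^2 + m j * z j) := by
    intro m; unfold nrm dot; rw [Finset.mul_sum, Finset.sum_add_distrib]
  simp only [e]
  rw [sum_prod_char ψ (fun j t => -(4*s)⁻¹ * t^2 + t * z j)]
  simp only [complete_sq hF hψ s _ hs]
  rw [Finset.prod_mul_distrib, Finset.prod_const, Finset.card_univ, Fintype.card_fin, nrm,
    Finset.mul_sum, psi_sum]

noncomputable def rho {F : Type} [Field F] [Fintype F] [DecidableEq F] {d : ℕ} (ψ : AddChar F ℂ)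
    (m : Fin d → F) : ℂ :=
  (Fintype.card F : ℂ)⁻¹ * (gs ψ ^ d)⁻¹ * qc (-1 : F) ^ d * KD ψ d (nrm m / 4)

lemma indicator_eq {F : Type} [Field F] [Fintype F] [DecidableEq F] (hF : ringChar F ≠ 2) {d : ℕ}
    {ψ : AddChar F ℂ} (hψ : ψ ≠ 1) (z : Fin d → F) :
    (if nrm z = 1 then (1:ℂ) else 0) - (Fintype.card F : ℂ)⁻¹ = ∑ m : Fin d → F, rho ψ m * ψ (dot m z) := by
  have hq0 : (Fintype.card F : ℂ) ≠ 0 := by exact_mod_cast Fintype.card_ne_zero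
  have hs0 : 0 < √(Fintype.card F : ℝ) := Real.sqrt_pos.2 (by exact_mod_cast Fintype.card_pos)
  have hg0 : gs ψ ≠ 0 := by
    rw [← norm_pos_iff, gs_norm hF hψ]; exact hs0
  have h1 : (if nrm z = 1 then (1:ℂ) else 0) - (Fintype.card F : ℂ)⁻¹ =
      (Fintype.card F : ℂ)⁻¹ * ∑ s ∈ univ.filter (fun x : F => x ≠ 0), ψ (s * (1 - nrm z)) := by
    have h := sum_mul_eq hψ (1 - nrm z)
    rw [← Finset.sum_erase_add univ _ (mem_univ (0:F)), ← Finset.filter_ne', zero_mul,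
      AddChar.map_zero_eq_one] at h
    rw [eq_sub_of_add_eq h, mul_sub, mul_one]
    congr 1
    simp only [sub_eq_zero, eq_comm (a := (1:F))]
    split_ifs
    · rw [inv_mul_cancel₀ hq0]
    · simp
  rw [h1]
  simp only [rho, KD, Finset.mul_sum, Finset.sum_mul]
  rw [Finset.sum_comm]
  refine Finset.sum_congr rfl fun s hs => ?_
  have hs : s ≠ 0 := by simpa using hs
  have h2 := char_nrm hF hψ (-s) (neg_ne_zero.2 hs) z
  rw [neg_neg] at h2
  have h3 : ψ (s * (1 - nrm z)) = ψ s * ψ (-s * nrm z) := by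
    rw [← AddChar.map_add_eq_mul]; congr 1; ring
  have hq1 : (qc s ^ d) ^ 2 = 1 := by rw [← pow_mul, mul_comm, pow_mul, qc_sq hs, one_pow]
  have h4 : ψ (-s * nrm z) = qc s ^ d * (gs ψ ^ d)⁻¹ * ∑ m : Fin d → F, ψ (-(4 * -s)⁻¹ * nrm m + dot m z) := by
    rw [h2, mul_pow]
    have : gs ψ ^ d ≠ 0 := pow_ne_zero _ hg0
    field_simp
    rw [hq1, mul_one]
  rw [h3, h4, Finset.mul_sum, Finset.mul_sum, Finset.mul_sum]
  refine Finset.sum_congr rfl fun m _ => ?_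
  have h5 : qc s = qc (-1 : F) * qc (-s) := by rw [← qc_mul]; simp
  have h6 : -(4 * -s)⁻¹ * nrm m = nrm m / 4 * s⁻¹ := by
    rw [mul_neg, inv_neg, neg_neg, mul_inv]; ring
  rw [h5, mul_pow, h6, AddChar.map_add_eq_mul, AddChar.map_add_eq_mul]
  ring

lemma rho_bound (p : ℕ) [Fact p.Prime] (hp2 : p ≠ 2) (F : Type) [Field F] [Fintype F]
    [DecidableEq F] [Algebra (ZMod p) F] {d : ℕ} (m : Fin d → F) :
    ‖rho (psi p F) m‖ * (Fintype.card F : ℝ)^d ≤ 2 * √(Fintype.card F)^d / √(Fintype.card F) := by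
  have hch : CharP F p := charP_of_injective_algebraMap (algebraMap (ZMod p) F).injective p
  have hF : ringChar F ≠ 2 := by rw [ringChar.eq F p]; exact hp2
  unfold rho
  rw [norm_mul, norm_mul, norm_mul, norm_inv, norm_inv, norm_pow, norm_pow, qc_norm (by simp),
    gs_norm hF (psi_ne_one p F), Complex.norm_natCast, one_pow, mul_one]
  have hk := KD_bound p hp2 F d (nrm m / 4)
  have hs0 : 0 < √(Fintype.card F : ℝ) := Real.sqrt_pos.2 (by exact_mod_cast Fintype.card_pos)
  have hq : (Fintype.card F : ℝ) = √(Fintype.card F : ℝ)^2 := (Real.sq_sqrt (by positivity)).symm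
  generalize hrr : √(Fintype.card F : ℝ) = r at *
  rw [hq]
  calc (r^2)⁻¹ * (r^d)⁻¹ * ‖KD (psi p F) d (nrm m / 4)‖ * (r^2)^d
      ≤ (r^2)⁻¹ * (r^d)⁻¹ * (2 * r) * (r^2)^d := by gcongr
    _ = 2 * r^d / r := by
      have : (r^2)^d = r^d * r^d := by rw [← pow_mul, two_mul, pow_add]
      rw [this]; field_simp

noncomputable def ft {F : Type} [Field F] [Fintype F] [DecidableEq F] {d : ℕ} (ψ : AddChar F ℂ)
    (f : (Fin d → F) → ℝ) (m : Fin d → F) : ℂ := ∑ x, (f x : ℂ) * ψ (dot m x)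

lemma dot_sub {F : Type} [Field F] {d : ℕ} (m x y : Fin d → F) : dot m (x - y) = dot m x + -dot m y := by
  unfold dot
  rw [← Finset.sum_neg_distrib, ← Finset.sum_add_distrib]
  refine Finset.sum_congr rfl fun j _ => ?_
  simp; ring

lemma conj_ft {F : Type} [Field F] [Fintype F] [DecidableEq F] {d : ℕ} (ψ : AddChar F ℂ)
    (f : (Fin d → F) → ℝ) (m : Fin d → F) :
    (starRingEnd ℂ) (ft ψ f m) = ∑ x, (f x : ℂ) * ψ (-dot m x) := by
  unfold ft
  rw [map_sum]
  refine Finset.sum_congr rfl fun x _ => ?_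
  rw [map_mul, Complex.conj_ofReal, AddChar.map_neg_eq_conj]

lemma ft_mul_conj {F : Type} [Field F] [Fintype F] [DecidableEq F] {d : ℕ} (ψ : AddChar F ℂ)
    (f g : (Fin d → F) → ℝ) (m : Fin d → F) :
    ft ψ f m * (starRingEnd ℂ) (ft ψ g m) = ∑ x, ∑ y, (f x : ℂ) * g y * ψ (dot m (x - y)) := by
  rw [conj_ft, ft, Finset.sum_mul_sum]
  refine Finset.sum_congr rfl fun x _ => Finset.sum_congr rfl fun y _ => ?_
  rw [dot_sub, AddChar.map_add_eq_mul]; ring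

lemma parseval {F : Type} [Field F] [Fintype F] [DecidableEq F] {d : ℕ} {ψ : AddChar F ℂ} (hψ : ψ ≠ 1)
    (f : (Fin d → F) → ℝ) :
    ∑ m, ‖ft ψ f m‖^2 = (Fintype.card F : ℝ)^d * ∑ x, f x ^ 2 := by
  have h : ((∑ m, ‖ft ψ f m‖^2 : ℝ) : ℂ) = (((Fintype.card F : ℝ)^d * ∑ x, f x ^ 2 : ℝ) : ℂ) := by
    push_cast
    calc ∑ m, (‖ft ψ f m‖ : ℂ)^2 = ∑ m, ∑ x, ∑ y, (f x : ℂ) * f y * ψ (dot m (x - y)) := by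
          refine Finset.sum_congr rfl fun m _ => ?_
          rw [← ft_mul_conj, Complex.mul_conj, Complex.normSq_eq_norm_sq]
          push_cast; rfl
      _ = ∑ x, ∑ y, (f x : ℂ) * f y * ∑ m, ψ (dot m (x - y)) := by
          rw [Finset.sum_comm]
          refine Finset.sum_congr rfl fun x _ => ?_
          rw [Finset.sum_comm]
          refine Finset.sum_congr rfl fun y _ => ?_
          rw [Finset.mul_sum]
      _ = _ := by
          simp only [sum_dot hψ, sub_eq_zero, mul_ite, mul_zero]
          rw [Finset.mul_sum]
          refine Finset.sum_congr rfl fun x _ => ?_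
          rw [Finset.sum_ite_eq, if_pos (mem_univ _)]; ring
  exact_mod_cast h

lemma bilinear (p : ℕ) [Fact p.Prime] (hp2 : p ≠ 2) (F : Type) [Field F] [Fintype F]
    [DecidableEq F] [Algebra (ZMod p) F] {d : ℕ} (f g : (Fin d → F) → ℝ) :
    ∑ x, ∑ y, (if nrm (x - y) = 1 then (1:ℝ) else 0) * f x * g y ≤
      (Fintype.card F : ℝ)⁻¹ * (∑ x, f x) * (∑ y, g y) +
      2 * √(Fintype.card F)^d / √(Fintype.card F) * √(∑ x, f x ^ 2) * √(∑ x, g x ^ 2) := by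
  have hch : CharP F p := charP_of_injective_algebraMap (algebraMap (ZMod p) F).injective p
  have hF : ringChar F ≠ 2 := by rw [ringChar.eq F p]; exact hp2
  have hψ := psi_ne_one p F
  set ψ := psi p F with hpsi
  set X : ℝ := ∑ x, ∑ y, (if nrm (x - y) = 1 then (1:ℝ) else 0) * f x * g y -
    (Fintype.card F : ℝ)⁻¹ * (∑ x, f x) * (∑ y, g y) with hX
  have h1 : (X : ℂ) = ∑ m, rho ψ m * (ft ψ f m * (starRingEnd ℂ) (ft ψ g m)) := by
    calc (X : ℂ) = ∑ x, ∑ y, ((if nrm (x - y) = 1 then (1:ℂ) else 0) - (Fintype.card F : ℂ)⁻¹) * (f x * g y) := by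
          rw [hX]
          push_cast
          rw [mul_assoc, Finset.sum_mul_sum, Finset.mul_sum, ← Finset.sum_sub_distrib]
          refine Finset.sum_congr rfl fun x _ => ?_
          rw [Finset.mul_sum, ← Finset.sum_sub_distrib]
          refine Finset.sum_congr rfl fun y _ => ?_
          split_ifs <;> push_cast <;> ring
      _ = ∑ x, ∑ y, ∑ m, rho ψ m * ((f x : ℂ) * g y * ψ (dot m (x - y))) := by
          refine Finset.sum_congr rfl fun x _ => Finset.sum_congr rfl fun y _ => ?_
          rw [indicator_eq hF hψ, Finset.sum_mul]
          refine Finset.sum_congr rfl fun m _ => ?_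
          ring
      _ = _ := by
          simp only [ft_mul_conj, Finset.mul_sum]
          symm
          rw [Finset.sum_comm]
          refine Finset.sum_congr rfl fun x _ => ?_
          rw [Finset.sum_comm]
  have hq0 : (0:ℝ) < Fintype.card F := by exact_mod_cast Fintype.card_pos
  set lam := 2 * √(Fintype.card F : ℝ)^d / √(Fintype.card F) with hlam
  have hlam0 : 0 ≤ lam := by positivity
  have h2 : X ≤ lam * √(∑ x, f x ^ 2) * √(∑ x, g x ^ 2) := by
    have h3 : X ≤ ‖(X:ℂ)‖ := by rw [Complex.norm_real]; exact le_abs_self X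
    refine h3.trans ?_
    rw [h1]
    refine (norm_sum_le _ _).trans ?_
    calc ∑ m, ‖rho ψ m * (ft ψ f m * (starRingEnd ℂ) (ft ψ g m))‖
        ≤ ∑ m, lam / (Fintype.card F : ℝ)^d * (‖ft ψ f m‖ * ‖ft ψ g m‖) := by
          refine Finset.sum_le_sum fun m _ => ?_
          rw [norm_mul, norm_mul, RCLike.norm_conj]
          gcongr
          rw [le_div_iff₀ (by positivity)]
          exact rho_bound p hp2 F m
      _ = lam / (Fintype.card F : ℝ)^d * ∑ m, ‖ft ψ f m‖ * ‖ft ψ g m‖ := by rw [Finset.mul_sum]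
      _ ≤ lam / (Fintype.card F : ℝ)^d * (√(∑ m, ‖ft ψ f m‖^2) * √(∑ m, ‖ft ψ g m‖^2)) := by
          gcongr
          exact Real.sum_mul_le_sqrt_mul_sqrt _ _ _
      _ = _ := by
          rw [parseval hψ, parseval hψ, Real.sqrt_mul (by positivity), Real.sqrt_mul (by positivity)]
          have h5 : √((Fintype.card F : ℝ)^d) * √((Fintype.card F : ℝ)^d) = (Fintype.card F : ℝ)^d :=
            Real.mul_self_sqrt (by positivity)
          have h6 : (Fintype.card F : ℝ)^d ≠ 0 := by positivity
          field_simp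
          linear_combination (lam * √(∑ x, f x ^ 2) * √(∑ x, g x ^ 2)) * h5
  linarith

noncomputable def fk {F : Type} [Field F] [Fintype F] [DecidableEq F] {d : ℕ} (E : Finset (Fin d → F)) :
    ℕ → (Fin d → F) → ℝ
  | 0, x => if x ∈ E then 1 else 0
  | k+1, x => (if x ∈ E then 1 else 0) * ∑ y, (if nrm (x - y) = 1 then (1:ℝ) else 0) * fk E k y

def chainP {F : Type} [Field F] [Fintype F] [DecidableEq F] {d : ℕ} (E : Finset (Fin d → F))
    (k : ℕ) (x : Fin (k+1) → Fin d → F) : Prop :=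
  (∀ i, x i ∈ E) ∧ ∀ i : Fin k, ∑ j, (x i.castSucc j - x i.succ j) ^ 2 = 1

open Classical in
lemma chain_sum {F : Type} [Field F] [Fintype F] [DecidableEq F] {d : ℕ} (E : Finset (Fin d → F))
    (k : ℕ) (h : (Fin d → F) → ℝ) :
    ∑ x : Fin (k+1) → Fin d → F, h (x 0) * (if chainP E k x then 1 else 0) = ∑ x, h x * fk E k x := by
  induction k generalizing h with
  | zero =>
    refine Fintype.sum_equiv (Equiv.funUnique (Fin 1) (Fin d → F)) _ _ fun x => ?_
    simp [chainP, fk]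
  | succ k ih =>
    rw [← (Fin.consEquiv (fun _ : Fin (k+1+1) => (Fin d → F))).sum_comp, Fintype.sum_prod_type]
    refine Finset.sum_congr rfl fun x0 _ => ?_
    have hc : ∀ x' : Fin (k+1) → Fin d → F,
        chainP E (k+1) (Fin.consEquiv (fun _ : Fin (k+1+1) => (Fin d → F)) (x0, x')) ↔
        x0 ∈ E ∧ nrm (x0 - x' 0) = 1 ∧ chainP E k x' := by
      intro x'
      have a1 : (∀ i, (Fin.cons x0 x' : Fin (k+1+1) → Fin d → F) i ∈ E) ↔ x0 ∈ E ∧ ∀ i, x' i ∈ E := by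
        rw [Fin.forall_fin_succ]; simp only [Fin.cons_zero, Fin.cons_succ]
      have a2 : (∀ i : Fin (k+1), ∑ j, ((Fin.cons x0 x' : Fin (k+1+1) → Fin d → F) i.castSucc j -
          (Fin.cons x0 x' : Fin (k+1+1) → Fin d → F) i.succ j) ^ 2 = 1) ↔
          ∑ j, (x0 j - x' 0 j)^2 = 1 ∧ ∀ i : Fin k, ∑ j, (x' i.castSucc j - x' i.succ j) ^ 2 = 1 := by
        rw [Fin.forall_fin_succ]
        simp only [Fin.cons_zero, Fin.cons_succ, Fin.castSucc_zero, ← Fin.succ_castSucc]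
      unfold chainP nrm
      simp only [Fin.consEquiv_apply, Pi.sub_apply]
      rw [a1, a2]
      tauto
    simp only [hc, fk]
    rw [← ih (fun y => if nrm (x0 - y) = 1 then (1:ℝ) else 0), Finset.mul_sum, Finset.mul_sum]
    refine Finset.sum_congr rfl fun x' _ => ?_
    simp only [Fin.consEquiv_apply, Fin.cons_zero]
    by_cases h1 : x0 ∈ E <;> by_cases h2 : nrm (x0 - x' 0) = 1 <;> by_cases h3 : chainP E k x' <;>
      simp [h1, h2, h3]

lemma chainCount_eq {F : Type} [Field F] [Fintype F] [DecidableEq F] {d : ℕ} (E : Finset (Fin d → F))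
    (k : ℕ) : (chainCount E k : ℝ) = ∑ x, fk E k x := by
  classical
  have h := chain_sum E k (fun _ => 1)
  simp only [one_mul] at h
  rw [← h, Finset.sum_boole]
  unfold chainCount chainP
  congr 2
  ext x
  simp only [Finset.mem_filter]

lemma fk_supp {F : Type} [Field F] [Fintype F] [DecidableEq F] {d : ℕ} (E : Finset (Fin d → F))
    (k : ℕ) (x : Fin d → F) : fk E k x = (if x ∈ E then 1 else 0) * fk E k x := by
  cases k <;> simp only [fk] <;> split_ifs <;> simp

lemma sum_fk_le {F : Type} [Field F] [Fintype F] [DecidableEq F] {d : ℕ} (E : Finset (Fin d → F))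
    (k : ℕ) : ∑ x, fk E k x ≤ √(E.card) * √(∑ x, fk E k x ^ 2) := by
  rw [Finset.sum_congr rfl fun x _ => fk_supp E k x]
  refine (Real.sum_mul_le_sqrt_mul_sqrt _ _ _).trans_eq ?_
  congr 2
  simp

lemma fk_nonneg {F : Type} [Field F] [Fintype F] [DecidableEq F] {d : ℕ} (E : Finset (Fin d → F))
    (k : ℕ) (x : Fin d → F) : 0 ≤ fk E k x := by
  induction k generalizing x with
  | zero => simp only [fk]; split_ifs <;> simp
  | succ k ih =>
    simp only [fk]
    refine mul_nonneg (by split_ifs <;> simp) (Finset.sum_nonneg fun y _ => mul_nonneg (by split_ifs <;> simp) (ih y))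

lemma fk_step (p : ℕ) [Fact p.Prime] (hp2 : p ≠ 2) (F : Type) [Field F] [Fintype F]
    [DecidableEq F] [Algebra (ZMod p) F] {d : ℕ} (E : Finset (Fin d → F)) (k : ℕ) :
    √(∑ x, fk E (k+1) x ^ 2) ≤
      ((E.card : ℝ) / Fintype.card F + 2 * √(Fintype.card F)^d / √(Fintype.card F)) * √(∑ x, fk E k x ^ 2) := by
  set lam := 2 * √(Fintype.card F : ℝ)^d / √(Fintype.card F) with hlam
  set A := √(∑ x, fk E (k+1) x ^ 2) with hA
  set B := √(∑ x, fk E k x ^ 2) with hB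
  have hA2 : A * A = ∑ x, fk E (k+1) x ^ 2 := Real.mul_self_sqrt (Finset.sum_nonneg fun _ _ => sq_nonneg _)
  have h := bilinear p hp2 F (fk E (k+1)) (fk E k)
  have e : ∑ x, ∑ y, (if nrm (x - y) = 1 then (1:ℝ) else 0) * fk E (k+1) x * fk E k y =
      ∑ x, fk E (k+1) x ^ 2 := by
    refine Finset.sum_congr rfl fun x _ => ?_
    have e1 : fk E (k+1) x ^ 2 = fk E (k+1) x *
        ∑ y, (if nrm (x - y) = 1 then (1:ℝ) else 0) * fk E k y := by
      rw [sq]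
      simp only [fk]
      split_ifs <;> simp
    rw [e1, Finset.mul_sum]
    refine Finset.sum_congr rfl fun y _ => ?_
    ring
  rw [e, ← hA, ← hB, ← hlam, ← hA2] at h
  have h1 := sum_fk_le E (k+1)
  have h2 := sum_fk_le E k
  rw [← hA] at h1
  rw [← hB] at h2
  have hA0 : 0 ≤ A := Real.sqrt_nonneg _
  have hB0 : 0 ≤ B := Real.sqrt_nonneg _
  have hE : √(E.card : ℝ) * √(E.card : ℝ) = E.card := Real.mul_self_sqrt (by positivity)
  have h3 : (∑ x, fk E (k+1) x) * (∑ x, fk E k x) ≤ (√(E.card) * A) * (√(E.card) * B) :=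
    mul_le_mul h1 h2 (Finset.sum_nonneg fun x _ => fk_nonneg E k x) (by positivity)
  have h4 : A * A ≤ A * (((E.card : ℝ) / Fintype.card F + lam) * B) := by
    refine h.trans ?_
    have h5 : (Fintype.card F : ℝ)⁻¹ * ((∑ x, fk E (k+1) x) * (∑ x, fk E k x)) ≤
        (Fintype.card F : ℝ)⁻¹ * ((√(E.card) * A) * (√(E.card) * B)) := by gcongr
    have h6 : (√(E.card : ℝ) * A) * (√(E.card) * B) = E.card * A * B := by
      linear_combination A * B * hE
    rw [h6] at h5
    rw [div_eq_mul_inv]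
    linarith
  rcases hA0.eq_or_lt with h0 | h0
  · rw [← h0]; positivity
  · exact le_of_mul_le_mul_left h4 h0

lemma chain_bound (p : ℕ) [Fact p.Prime] (hp2 : p ≠ 2) (F : Type) [Field F] [Fintype F]
    [DecidableEq F] [Algebra (ZMod p) F] {d : ℕ} (E : Finset (Fin d → F)) (k : ℕ) :
    (chainCount E k : ℝ) ≤ E.card *
      ((E.card : ℝ) / Fintype.card F + 2 * √(Fintype.card F)^d / √(Fintype.card F))^k := by
  set Λ := (E.card : ℝ) / Fintype.card F + 2 * √(Fintype.card F)^d / √(Fintype.card F) with hΛ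
  have hΛ0 : 0 ≤ Λ := by positivity
  have h : √(∑ x, fk E k x ^ 2) ≤ Λ^k * √(E.card) := by
    induction k with
    | zero => simp [fk]
    | succ k ih =>
      refine (fk_step p hp2 F E k).trans ?_
      rw [← hΛ, pow_succ']
      rw [mul_assoc]
      gcongr
  rw [chainCount_eq]
  refine (sum_fk_le E k).trans ?_
  calc √(E.card : ℝ) * √(∑ x, fk E k x ^ 2) ≤ √(E.card) * (Λ^k * √(E.card)) := by gcongr
    _ = _ := by
      have hE : √(E.card : ℝ) * √(E.card : ℝ) = E.card := Real.mul_self_sqrt (by positivity)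
      linear_combination Λ^k * hE

end KL

theorem statement12 {F : Type} [Field F] [Fintype F] [DecidableEq F]
    (q : ℕ) (hq : Fintype.card F = q) (hodd : Odd q)
    (d : ℕ) (hd : 2 ≤ d)
    (E : Finset (Fin d → F)) (n : ℕ)
    (hE : (4 * (n : ℝ) / Real.log 2) * (q : ℝ) ^ (((d : ℝ) + 1) / 2) ≤ (E.card : ℝ)) :
    (chainCount E (2 * n) : ℝ) ≤ 2 * (E.card : ℝ) ^ (2 * n + 1) / (q : ℝ) ^ (2 * n) := by
  subst hq
  obtain ⟨p, hp⟩ := CharP.exists F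
  have hpp : Fact p.Prime := ⟨CharP.char_is_prime F p⟩
  have hp2 : p ≠ 2 := by
    rintro rfl
    have h2 := FiniteField.even_card_iff_char_two.1 (ringChar.eq F 2)
    rw [Nat.odd_iff] at hodd
    omega
  let alg : Algebra (ZMod p) F := ZMod.algebra F p
  have hb := KL.chain_bound p hp2 F E (2*n)
  refine hb.trans ?_
  have hq0 : (0:ℝ) < Fintype.card F := by exact_mod_cast Fintype.card_pos
  set r := √(Fintype.card F : ℝ) with hr
  have hr0 : 0 < r := Real.sqrt_pos.2 hq0
  have hr2 : (Fintype.card F : ℝ) = r^2 := (Real.sq_sqrt hq0.le).symm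
  have hpow : (Fintype.card F : ℝ) ^ (((d : ℝ) + 1) / 2) = r^(d+1) := by
    rw [hr, Real.sqrt_eq_rpow, ← Real.rpow_natCast, ← Real.rpow_mul hq0.le]
    congr 1; push_cast; ring
  rw [hpow] at hE
  rcases Nat.eq_zero_or_pos n with hn | hn
  · subst hn; simp; linarith [(Nat.cast_nonneg E.card : (0:ℝ) ≤ E.card)]
  have hn0 : (0:ℝ) < n := by exact_mod_cast hn
  have hl : 0 < Real.log 2 := Real.log_pos (by norm_num)
  have he0 : (0:ℝ) ≤ (E.card : ℝ) := Nat.cast_nonneg _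
  rw [hr2]
  clear hpow hr2 hb
  clear_value r
  clear hr
  generalize (E.card : ℝ) = e at *
  have hlam : 2 * r^d / r ≤ e / r^2 * (Real.log 2 / (2 * n)) := by
    have h1 : 4 * n * r^(d+1) ≤ e * Real.log 2 := by
      rw [div_mul_eq_mul_div, div_le_iff₀ hl] at hE; exact hE
    rw [div_mul_div_comm, div_le_div_iff₀ hr0 (by positivity)]
    calc 2 * r^d * (r^2 * (2 * n)) = (4 * n * r^(d+1)) * r := by ring
      _ ≤ (e * Real.log 2) * r := by gcongr
  have hL : e / r^2 + 2 * r^d / r ≤ e / r^2 * Real.exp (Real.log 2 / (2*n)) := by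
    calc e / r^2 + 2 * r^d / r ≤ e / r^2 + e / r^2 * (Real.log 2 / (2 * n)) := by gcongr
      _ = e / r^2 * (Real.log 2 / (2*n) + 1) := by ring
      _ ≤ _ := by gcongr; exact Real.add_one_le_exp _
  calc e * (e / r^2 + 2 * r^d / r)^(2*n) ≤ e * (e / r^2 * Real.exp (Real.log 2 / (2*n)))^(2*n) := by
        gcongr
    _ = e * (e^(2*n) / (r^2)^(2*n) * 2) := by
        rw [mul_pow, div_pow, ← Real.exp_nat_mul]
        congr 3
        have : ((2 * n : ℕ) : ℝ) * (Real.log 2 / (2*n)) = Real.log 2 := by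
          push_cast; field_simp
        rw [this, Real.exp_log (by norm_num)]
    _ = _ := by rw [pow_succ e]; ring
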